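/- Let γ : ℝ → ℝ³ be a non-degenerate C² curve on S² and define the unit normal ν(θ) := γ(θ) × γ'(θ)/|γ'(θ)| (note |γ(θ) × γ'(θ)| = |γ'(θ)| since |γ(θ)| = 1 and γ(θ) ⊥ γ'(θ)). Then ν is continuously differentiable on [0,1], and for every θ ∈ [0,1] there exists λ(θ) ∈ ℝ with λ(θ) ≠ 0 such that ν'(θ) = λ(θ) γ'(θ). In particular, the dual curve ν is a regular curve on S² whose tangent direction at ν(θ) is parallel to the tangent direction of γ at γ(θ). -/

import Mathlib

open Set

/-- The cross product on `ℝ³ = EuclideanSpace ℝ (Fin 3)`. -/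
noncomputable def cross3 (a b : EuclideanSpace ℝ (Fin 3)) : EuclideanSpace ℝ (Fin 3) :=
  (EuclideanSpace.equiv (Fin 3) ℝ).symm
    ![a 1 * b 2 - a 2 * b 1, a 2 * b 0 - a 0 * b 2, a 0 * b 1 - a 1 * b 0]

theorem inner_euclidean_three (a b : EuclideanSpace ℝ (Fin 3)) :
    inner ℝ a b = a 0 * b 0 + a 1 * b 1 + a 2 * b 2 := by
  simp only [PiLp.inner_apply, Fin.sum_univ_three, Real.inner_apply]

theorem cross3_self (a : EuclideanSpace ℝ (Fin 3)) : cross3 a a = 0 := by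
  ext i
  fin_cases i <;> simp [cross3] <;> ring

theorem ContDiffOn.cross3 {n : WithTop ℕ∞} {s : Set ℝ} {f g : ℝ → EuclideanSpace ℝ (Fin 3)}
    (hf : ContDiffOn ℝ n f s) (hg : ContDiffOn ℝ n g s) :
    ContDiffOn ℝ n (fun t => cross3 (f t) (g t)) s := by
  rw [contDiffOn_euclidean] at hf hg ⊢
  intro i
  fin_cases i
  · exact ((hf 1).mul (hg 2)).sub ((hf 2).mul (hg 1))
  · exact ((hf 2).mul (hg 0)).sub ((hf 0).mul (hg 2))
  · exact ((hf 0).mul (hg 1)).sub ((hf 1).mul (hg 0))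

theorem HasDerivAt.cross3 {f g : ℝ → EuclideanSpace ℝ (Fin 3)}
    {f' g' : EuclideanSpace ℝ (Fin 3)} {t : ℝ}
    (hf : HasDerivAt f f' t) (hg : HasDerivAt g g' t) :
    HasDerivAt (fun t => cross3 (f t) (g t)) (cross3 f' (g t) + cross3 (f t) g') t := by
  have hf (i : Fin 3) : HasDerivAt (fun t => f t i) (f' i) t :=
    (EuclideanSpace.proj (𝕜 := ℝ) i).hasFDerivAt.comp_hasDerivAt t hf
  have hg (i : Fin 3) : HasDerivAt (fun t => g t i) (g' i) t :=
    (EuclideanSpace.proj (𝕜 := ℝ) i).hasFDerivAt.comp_hasDerivAt t hg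
  have h : HasDerivAt
      (fun t => ![f t 1 * g t 2 - f t 2 * g t 1, f t 2 * g t 0 - f t 0 * g t 2,
        f t 0 * g t 1 - f t 1 * g t 0])
      (EuclideanSpace.equiv (Fin 3) ℝ (_root_.cross3 f' (g t) + _root_.cross3 (f t) g')) t := by
    rw [hasDerivAt_pi]
    intro i
    fin_cases i
    · exact (((hf 1).mul (hg 2)).sub ((hf 2).mul (hg 1))).congr_deriv (add_sub_add_comm _ _ _ _)
    · exact (((hf 2).mul (hg 0)).sub ((hf 0).mul (hg 2))).congr_deriv (add_sub_add_comm _ _ _ _)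
    · exact (((hf 0).mul (hg 1)).sub ((hf 1).mul (hg 0))).congr_deriv (add_sub_add_comm _ _ _ _)
  exact ((EuclideanSpace.equiv (Fin 3) ℝ).symm.hasFDerivAt.comp_hasDerivAt t h).congr_deriv
    ((EuclideanSpace.equiv (Fin 3) ℝ).symm_apply_apply _)

/-- If `a ⊥ b` then `|b|² a × c - (b · c) a × b = -(a · (b × c)) b`. -/
theorem normSq_smul_cross3_sub {a b : EuclideanSpace ℝ (Fin 3)}
    (hab : inner ℝ a b = 0) (c : EuclideanSpace ℝ (Fin 3)) :
    ‖b‖ ^ 2 • cross3 a c - (inner ℝ b c : ℝ) • cross3 a b =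
      -(inner ℝ a (cross3 b c) : ℝ) • b := by
  rw [← real_inner_self_eq_norm_sq]
  simp only [inner_euclidean_three] at hab ⊢
  ext i
  fin_cases i <;> simp [cross3]
  · linear_combination (b 1 * c 2 - b 2 * c 1) * hab
  · linear_combination (b 2 * c 0 - b 0 * c 2) * hab
  · linear_combination (b 0 * c 1 - b 1 * c 0) * hab

theorem LinearIndependent.inner_cross3_ne_zero {a b c : EuclideanSpace ℝ (Fin 3)}
    (h : LinearIndependent ℝ ![a, b, c]) : inner ℝ a (cross3 b c) ≠ 0 := by
  have h' := h.map' (EuclideanSpace.equiv (Fin 3) ℝ).toLinearEquiv.toLinearMap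
    (LinearEquiv.ker _)
  have hu := Matrix.linearIndependent_rows_iff_isUnit
    (A := Matrix.of ![(a : Fin 3 → ℝ), (b : Fin 3 → ℝ), (c : Fin 3 → ℝ)]) |>.1 <| by
      have hrows : (Matrix.of ![(a : Fin 3 → ℝ), (b : Fin 3 → ℝ), (c : Fin 3 → ℝ)]).row =
          EuclideanSpace.equiv (Fin 3) ℝ ∘ ![a, b, c] := by
        ext i j
        fin_cases i <;> rfl
      rw [hrows]
      exact h'
  have hd := ((Matrix.isUnit_iff_isUnit_det _).1 hu).ne_zero
  rw [Matrix.det_fin_three] at hd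
  intro h0
  apply hd
  rw [inner_euclidean_three] at h0
  simp [cross3] at h0 ⊢
  linear_combination h0

theorem inner_deriv_eq_zero_of_norm_eq_one {E : Type*} [NormedAddCommGroup E]
    [InnerProductSpace ℝ E] {f : ℝ → E} {s : Set ℝ} (hs : UniqueDiffOn ℝ s)
    (h : ∀ t ∈ s, ‖f t‖ = 1) {t : ℝ} (ht : t ∈ s) (hf : DifferentiableAt ℝ f t) :
    inner ℝ (f t) (deriv f t) = 0 := by
  have h1 := hf.hasDerivAt.hasDerivWithinAt (s := s).norm_sq
  have h2 : HasDerivWithinAt (‖f ·‖ ^ 2) 0 s t :=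
    (hasDerivWithinAt_const t s (1 : ℝ)).congr (fun x hx => by simp [h x hx]) (by simp [h t ht])
  have := (hs t ht).eq_deriv s h1 h2
  linarith

/-- For a non-degenerate C² curve `γ` on `S²`, the unit normal
`ν(θ) = γ(θ) × γ'(θ)/|γ'(θ)|` is continuously differentiable on `[0,1]` and for every
`θ ∈ [0,1]` there is a nonzero `λ(θ) ∈ ℝ` with `ν'(θ) = λ(θ) γ'(θ)`. -/
theorem stmt17 (γ : ℝ → EuclideanSpace ℝ (Fin 3))
    (hγ : ContDiff ℝ 2 γ)
    (hsphere : ∀ θ ∈ Icc (0:ℝ) 1, ‖γ θ‖ = 1)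
    (hnondeg : ∀ θ ∈ Icc (0:ℝ) 1,
      LinearIndependent ℝ ![γ θ, deriv γ θ, deriv (deriv γ) θ]) :
    ContDiffOn ℝ 1
        (fun θ => (‖deriv γ θ‖)⁻¹ • cross3 (γ θ) (deriv γ θ)) (Icc (0:ℝ) 1) ∧
      ∀ θ ∈ Icc (0:ℝ) 1, ∃ l : ℝ, l ≠ 0 ∧
        deriv (fun θ => (‖deriv γ θ‖)⁻¹ • cross3 (γ θ) (deriv γ θ)) θ
          = l • deriv γ θ := by
  have hγ' : ContDiff ℝ 1 (deriv γ) := hγ.deriv'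
  have hne : ∀ θ ∈ Icc (0:ℝ) 1, deriv γ θ ≠ 0 := fun θ hθ => (hnondeg θ hθ).ne_zero 1
  refine ⟨?_, fun θ hθ => ?_⟩
  · exact ((hγ'.contDiffOn.norm ℝ hne).inv fun θ hθ => norm_ne_zero_iff.2 (hne θ hθ)).smul
      ((hγ.of_le one_le_two).contDiffOn.cross3 hγ'.contDiffOn)
  have hγd : DifferentiableAt ℝ γ θ := hγ.differentiable (by norm_num) θ
  have hγd' := (hγ'.differentiable one_ne_zero θ).hasDerivAt
  have horth := inner_deriv_eq_zero_of_norm_eq_one (uniqueDiffOn_Icc one_pos) hsphere hθ hγd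
  have hpos : ‖deriv γ θ‖ ≠ 0 := norm_ne_zero_iff.2 (hne θ hθ)
  have hnorm : HasDerivAt (fun t => ‖deriv γ t‖)
      (inner ℝ (deriv γ θ) (deriv (deriv γ) θ) / ‖deriv γ θ‖) θ := by
    convert hγd'.norm_sq.sqrt (by positivity) using 1
    · simp
    · simp [mul_div_mul_left]
  refine ⟨-inner ℝ (γ θ) (cross3 (deriv γ θ) (deriv (deriv γ) θ)) / ‖deriv γ θ‖ ^ 3,
    div_ne_zero (neg_ne_zero.2 (hnondeg θ hθ).inner_cross3_ne_zero) (pow_ne_zero 3 hpos), ?_⟩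
  refine ((hnorm.inv hpos).smul (hγd.hasDerivAt.cross3 hγd')).deriv.trans ?_
  rw [div_eq_inv_mul _ (‖deriv γ θ‖ ^ 3), mul_smul, ← normSq_smul_cross3_sub horth, cross3_self,
    zero_add, Pi.inv_apply]
  match_scalars <;> field_simp
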